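/- arXiv:1408.4862 — 2 statements merged into one kernel-verified Lean document; each statement's English description precedes it below -/
import Mathlib

section
/- Let G be a finite directed graph on the vertex set {1,…,n} and let q ≥ 2 be an integer. Let M* denote the maximum size of an RDSS code for G over ZMod q, and let L* denote the minimum size of a message set M for which an index code for G over ZMod q exists. Then q^n ≤ M* · L*, and moreover L* ≤ ⌈(q^n / M*) · min{ n·ln q, 1 + ln M* }⌉. -/
/-- A recoverable distributed storage system (RDSS) code for the directed graph with
adjacency relation `Adj` on `Fin n`, over alphabet `A`. -/
def IsRDSS {n : ℕ} {A : Type*} (Adj : Fin n → Fin n → Prop) (C : Set (Fin n → A)) : Prop :=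
  ∀ i : Fin n, ∀ x ∈ C, ∀ y ∈ C, (∀ j : Fin n, Adj i j → x j = y j) → x i = y i

/-- Averaging over all translates: some translate of `C` meets `U` in at least the expected
number of points. -/
theorem exists_translate_card_inter_ge {G : Type*} [AddCommGroup G] [Fintype G] [DecidableEq G]
    (C U : Finset G) :
    ∃ t : G, U.card * C.card ≤ Fintype.card G * (U.filter fun x => x - t ∈ C).card := by
  by_contra! h
  have hsum : ∑ t : G, (U.filter fun x => x - t ∈ C).card = U.card * C.card := by
    simp_rw [Finset.card_filter]
    rw [Finset.sum_comm, Finset.card_eq_sum_ones U, Finset.sum_mul]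
    refine Finset.sum_congr rfl fun x _ => ?_
    rw [one_mul, ← Finset.card_filter]
    refine Finset.card_bij' (fun t _ => x - t) (fun c _ => x - c) ?_ ?_ ?_ ?_ <;> simp
  have hlt := Finset.sum_lt_sum_of_nonempty (Finset.univ_nonempty (α := G)) fun t _ => h t
  rw [← Finset.mul_sum, hsum] at hlt
  simp at hlt

/-- Greedily chosen translates of `C` leave at most the expected number of points uncovered. -/
theorem exists_translates_card_uncovered_le {G : Type*} [AddCommGroup G] [Fintype G]
    [DecidableEq G] (C : Finset G) (k : ℕ) :
    ∃ T : Fin k → G, ((Finset.univ.filter fun x => ∀ j, x - T j ∉ C).card : ℝ) ≤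
      Fintype.card G * (1 - (C.card : ℝ) / Fintype.card G) ^ k := by
  induction k with
  | zero => exact ⟨Fin.elim0, by simp⟩
  | succ k ih =>
    obtain ⟨T, hT⟩ := ih
    set U := Finset.univ.filter fun x => ∀ j, x - T j ∉ C
    obtain ⟨t, ht⟩ := exists_translate_card_inter_ge C U
    refine ⟨Fin.cons t T, ?_⟩
    have hN : (0 : ℝ) < Fintype.card G := by exact_mod_cast Fintype.card_pos
    have hle : (C.card : ℝ) / Fintype.card G ≤ 1 := by
      rw [div_le_one hN]
      exact_mod_cast C.card_le_univ
    have heq : (Finset.univ.filter fun x => ∀ j, x - (Fin.cons t T : Fin (k + 1) → G) j ∉ C) =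
        U.filter fun x => ¬ x - t ∈ C := by
      ext x
      simp [U, Fin.forall_fin_succ, and_comm]
    have hsplit : ((U.filter fun x => x - t ∈ C).card : ℝ) +
        (U.filter fun x => ¬ x - t ∈ C).card = U.card := by
      exact_mod_cast Finset.card_filter_add_card_filter_not (s := U) _
    have ht' : (U.card : ℝ) * C.card / Fintype.card G ≤ (U.filter fun x => x - t ∈ C).card := by
      rw [div_le_iff₀' hN]
      exact_mod_cast ht
    rw [heq, pow_succ, ← mul_assoc]
    calc ((U.filter fun x => ¬ x - t ∈ C).card : ℝ)
        ≤ U.card * (1 - (C.card : ℝ) / Fintype.card G) := by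
          rw [mul_sub, mul_one, ← mul_div_assoc]
          linarith
      _ ≤ _ := mul_le_mul_of_nonneg_right hT (by linarith)

theorem IsRDSS.translate {n : ℕ} {A : Type*} [AddCommGroup A] {Adj : Fin n → Fin n → Prop}
    {C : Set (Fin n → A)} (hC : IsRDSS Adj C) (t : Fin n → A) :
    IsRDSS Adj {x | x - t ∈ C} := by
  intro i x hx y hy hxy
  simpa using hC i _ hx _ hy fun j hj => by simp [hxy j hj]

theorem isRDSS_singleton {n : ℕ} {A : Type*} (Adj : Fin n → Fin n → Prop) (x : Fin n → A) :
    IsRDSS Adj {x} := by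
  rintro i _ rfl _ rfl _
  rfl

/-- A cover of the whole space by RDSS codes indexed by `M` gives an index code with
message set `M`. -/
theorem exists_indexCode_of_cover {n : ℕ} {A M : Type*} [Nonempty A] {Adj : Fin n → Fin n → Prop}
    (C : M → Set (Fin n → A)) (hC : ∀ m, IsRDSS Adj (C m)) (hcov : ∀ y, ∃ m, y ∈ C m) :
    ∃ (f : (Fin n → A) → M) (g : (i : Fin n) → M → ({j : Fin n // Adj i j} → A) → A),
      ∀ y i, g i (f y) (fun j => y j.1) = y i := by
  classical
  choose f hf using hcov
  refine ⟨f, fun i m z => if h : ∃ x ∈ C m, ∀ j : {j // Adj i j}, x j.1 = z j then h.choose i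
    else Classical.arbitrary A, fun y i => ?_⟩
  have h : ∃ x ∈ C (f y), ∀ j : {j // Adj i j}, x j.1 = y j.1 := ⟨y, hf y, fun _ => rfl⟩
  beta_reduce
  rw [dif_pos h]
  exact hC _ i _ h.choose_spec.1 _ (hf y) fun j hj => h.choose_spec.2 ⟨j, hj⟩

/-- The messages with a given encoding form an RDSS code. -/
theorem isRDSS_fiber {n : ℕ} {A M : Type*} {Adj : Fin n → Fin n → Prop} {f : (Fin n → A) → M}
    {g : (i : Fin n) → M → ({j : Fin n // Adj i j} → A) → A}
    (hfg : ∀ y i, g i (f y) (fun j => y j.1) = y i) (m : M) : IsRDSS Adj {y | f y = m} := by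
  intro i x hx y hy hxy
  rw [← hfg x i, ← hfg y i, show f x = m from hx, show f y = m from hy]
  congr 1
  funext j
  exact hxy j.1 j.2

theorem mul_exp_neg_div_pow_le {N c b : ℝ} {k : ℕ} (hN : 0 < N) (hc : 0 < c) (hb : 0 < b)
    (hk : N / c * Real.log b ≤ k) : N * Real.exp (-(c / N)) ^ k ≤ N / b := by
  have hlog : Real.log b ≤ k * (c / N) := by
    calc Real.log b = N / c * Real.log b * (c / N) := by field_simp
      _ ≤ _ := mul_le_mul_of_nonneg_right hk (by positivity)
  rw [div_eq_mul_inv N b, ← Real.exp_nat_mul, ← Real.exp_log (inv_pos.2 hb), Real.log_inv]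
  exact mul_le_mul_of_nonneg_left (Real.exp_le_exp.2 (by linarith)) hN.le

/-- If `k * c ≥ N * log b`, then `k` greedy steps leave at most `N / b` points uncovered. -/
theorem mul_one_sub_div_pow_le {N c b : ℝ} {k : ℕ} (hN : 0 < N) (hcN : c ≤ N) (hc : 0 < c)
    (hb : 0 < b) (hk : N / c * Real.log b ≤ k) : N * (1 - c / N) ^ k ≤ N / b :=
  (mul_le_mul_of_nonneg_left (pow_le_pow_left₀ (by rwa [sub_nonneg, div_le_one hN])
    (Real.one_sub_le_exp_neg _) k) hN.le).trans (mul_exp_neg_div_pow_le hN hc hb hk)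

/-- The strict form of `mul_one_sub_div_pow_le`. -/
theorem mul_one_sub_div_pow_lt {N c b : ℝ} {k : ℕ} (hN : 0 < N) (hcN : c ≤ N) (hc : 0 < c)
    (hb : 0 < b) (hk0 : k ≠ 0) (hk : N / c * Real.log b ≤ k) : N * (1 - c / N) ^ k < N / b :=
  (mul_lt_mul_of_pos_left (pow_lt_pow_left₀ (Real.one_sub_lt_exp_neg (by positivity))
    (by rwa [sub_nonneg, div_le_one hN]) hk0) hN).trans_le (mul_exp_neg_div_pow_le hN hc hb hk)

/-- duality between optimal RDSS codes and optimal index codes: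
if `Mstar` is the maximum size of an RDSS code for `G` over `ZMod q` and `Lstar`
is the minimum size of a message set of an index code for `G` over `ZMod q`,
then `q^n ≤ Mstar * Lstar` and
`Lstar ≤ ⌈(q^n/Mstar) · min(n ln q, 1 + ln Mstar)⌉`. -/
theorem stmt7 {n q : ℕ} (hn : 1 ≤ n) (hq : 2 ≤ q)
    (Adj : Fin n → Fin n → Prop) (hirr : ∀ i, ¬ Adj i i)
    (Mstar Lstar : ℕ)
    (hMstar : IsGreatest {k : ℕ |
      ∃ C : Set (Fin n → ZMod q), IsRDSS Adj C ∧ C.ncard = k} Mstar)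
    (hLstar : IsLeast {m : ℕ | ∃ (M : Type) (hFM : Fintype M)
      (f : (Fin n → ZMod q) → M)
      (g : (i : Fin n) → M → ({j : Fin n // Adj i j} → ZMod q) → ZMod q),
      (∀ y : Fin n → ZMod q, ∀ i : Fin n, g i (f y) (fun j => y j.1) = y i) ∧
      @Fintype.card M hFM = m} Lstar) :
    q ^ n ≤ Mstar * Lstar ∧
      Lstar ≤ ⌈((q : ℝ) ^ n / (Mstar : ℝ)) *
        min ((n : ℝ) * Real.log q) (1 + Real.log (Mstar : ℝ))⌉₊ := by
  classical
  have : NeZero q := ⟨by omega⟩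
  obtain ⟨⟨C, hC, hCcard⟩, hmax⟩ := hMstar
  obtain ⟨⟨M, hFM, f, g, hfg, hLcard⟩, hmin⟩ := hLstar
  have hcard : Fintype.card (Fin n → ZMod q) = q ^ n := by simp [ZMod.card]
  have hM1 : 1 ≤ Mstar := hmax ⟨{0}, isRDSS_singleton Adj 0, Set.ncard_singleton 0⟩
  refine ⟨?_, ?_⟩
  · rw [← hcard, ← Finset.card_univ, ← hLcard, ← Finset.card_univ]
    refine Finset.card_le_mul_card_image_of_maps_to (f := f) (fun _ _ => Finset.mem_univ _) _
      fun m _ => hmax ⟨{y | f y = m}, isRDSS_fiber hfg m, ?_⟩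
    rw [← Set.ncard_coe_finset]
    simp
  have hcover : ∀ (ι : Type) [Fintype ι] (D : ι → Set (Fin n → ZMod q)),
      (∀ m, IsRDSS Adj (D m)) → (∀ y, ∃ m, y ∈ D m) → Lstar ≤ Fintype.card ι := by
    intro ι _ D hD hcov
    obtain ⟨f', g', h⟩ := exists_indexCode_of_cover D hD hcov
    exact hmin ⟨ι, inferInstance, f', g', h, rfl⟩
  have hCF : C.toFinset.card = Mstar := by rw [← hCcard, Set.ncard_eq_toFinset_card']
  have hMN : Mstar ≤ q ^ n := by rw [← hCF, ← hcard]; exact Finset.card_le_univ _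
  have hMpos : (0 : ℝ) < Mstar := by exact_mod_cast hM1
  have hNpos : (0 : ℝ) < (q : ℝ) ^ n := by positivity
  have hMN' : (Mstar : ℝ) ≤ (q : ℝ) ^ n := by exact_mod_cast hMN
  have hgreedy : ∀ k : ℕ, ∃ T : Fin k → Fin n → ZMod q,
      ((Finset.univ.filter fun x => ∀ j, x - T j ∉ C).card : ℝ) ≤
        (q : ℝ) ^ n * (1 - Mstar / (q : ℝ) ^ n) ^ k := by
    intro k
    obtain ⟨T, hT⟩ := exists_translates_card_uncovered_le C.toFinset k
    rw [hCF, hcard] at hT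
    exact ⟨T, by simpa using hT⟩
  rw [mul_min_of_nonneg _ _ (by positivity), Nat.ceil_mono.map_min]
  refine le_min ?_ ?_
  · set k := ⌈(q : ℝ) ^ n / Mstar * (n * Real.log q)⌉₊
    have hk : (q : ℝ) ^ n / Mstar * Real.log ((q : ℝ) ^ n) ≤ k := by
      rw [Real.log_pow]
      exact Nat.le_ceil _
    have hlogq : 0 < Real.log q := Real.log_pos (by exact_mod_cast hq)
    have hk0 : k ≠ 0 := by
      have : (0 : ℝ) < n := by exact_mod_cast hn
      exact (Nat.ceil_pos.2 (by positivity)).ne'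
    obtain ⟨T, hT⟩ := hgreedy k
    have hlt := hT.trans_lt (mul_one_sub_div_pow_lt hNpos hMN' hMpos hNpos hk0 hk)
    rw [div_self hNpos.ne', Nat.cast_lt_one, Finset.card_eq_zero] at hlt
    simpa using hcover (Fin k) (fun j => {x | x - T j ∈ C}) (fun j => hC.translate (T j))
      fun y => by
        by_contra! hy
        exact Finset.notMem_empty y (hlt ▸ by simpa using hy)
  · set k := ⌈(q : ℝ) ^ n / Mstar * Real.log Mstar⌉₊ with hkdef
    obtain ⟨T, hT⟩ := hgreedy k
    set U := Finset.univ.filter fun x => ∀ j, x - T j ∉ C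
    have hU : (U.card : ℝ) ≤ (q : ℝ) ^ n / Mstar :=
      hT.trans (mul_one_sub_div_pow_le hNpos hMN' hMpos hMpos (Nat.le_ceil _))
    have hL : Lstar ≤ k + U.card := by
      simpa using hcover (Fin k ⊕ U) (Sum.elim (fun j => {x | x - T j ∈ C}) fun u => {u.1})
        (by rintro (j | u); exacts [hC.translate (T j), isRDSS_singleton Adj u.1])
        fun y => by
          by_cases hy : y ∈ U
          · exact ⟨Sum.inr ⟨y, hy⟩, rfl⟩
          · simp only [U, Finset.mem_filter, Finset.mem_univ, true_and, not_forall, not_not] at hy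
            obtain ⟨j, hj⟩ := hy
            exact ⟨Sum.inl j, hj⟩
    have hlogM : 0 ≤ Real.log Mstar := Real.log_natCast_nonneg _
    refine hL.trans ?_
    rw [hkdef, ← Nat.ceil_add_natCast (by positivity)]
    exact Nat.ceil_mono (by linarith)
end

section
/- Let n ≥ 1 and q ≥ 2 be integers and let K_n be the complete simple undirected graph on the vertex set {1,…,n}. Then the maximum size of an RDSS code for K_n over ZMod q equals q^{n−1}: the set of all vectors in (ZMod q)^n whose coordinates sum to 0 is an RDSS code for K_n of size q^{n−1}, and every RDSS code for K_n over an alphabet of size q has size at most q^{n−1}. -/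
theorem isRDSS_top_zero_sum {n : ℕ} {A : Type*} [AddCommGroup A] :
    IsRDSS (⊤ : SimpleGraph (Fin n)).Adj {x : Fin n → A | ∑ i, x i = 0} := by
  intro i x hx y hy h
  have hsum : ∑ j ∈ Finset.univ.erase i, x j = ∑ j ∈ Finset.univ.erase i, y j :=
    Finset.sum_congr rfl fun j hj => h j (Finset.ne_of_mem_erase hj).symm
  have hx' := Finset.add_sum_erase Finset.univ x (Finset.mem_univ i)
  have hy' := Finset.add_sum_erase Finset.univ y (Finset.mem_univ i)
  rw [Set.mem_ofPred_eq] at hx hy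
  rw [hx, hsum] at hx'
  rw [hy] at hy'
  exact add_right_cancel (hx'.trans hy'.symm)

theorem ncard_zero_sum {m : ℕ} {A : Type*} [AddCommGroup A] :
    {x : Fin (m + 1) → A | ∑ i, x i = 0}.ncard = Nat.card A ^ m := by
  have himage : {x : Fin (m + 1) → A | ∑ i, x i = 0} =
      (fun y : Fin m → A => (Fin.cons (-∑ i, y i) y : Fin (m + 1) → A)) '' Set.univ := by
    ext x
    simp only [Set.mem_ofPred_eq, Set.image_univ, Set.mem_range]
    constructor
    · intro hx
      refine ⟨Fin.tail x, ?_⟩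
      rw [Fin.sum_univ_succ] at hx
      have h0 : -∑ i, Fin.tail x i = x 0 := (eq_neg_of_add_eq_zero_left hx).symm
      rw [h0, Fin.cons_self_tail]
    · rintro ⟨y, rfl⟩
      simp [Fin.sum_univ_succ]
  have hinj : Function.Injective
      fun y : Fin m → A => (Fin.cons (-∑ i, y i) y : Fin (m + 1) → A) :=
    fun y z h => (Fin.cons_injective2 h).2
  rw [himage, Set.ncard_image_of_injective _ hinj,
    Set.ncard_univ, Nat.card_fun, Nat.card_fin]

theorem IsRDSS.injOn_tail {m : ℕ} {A : Type*} {C : Set (Fin (m + 1) → A)}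
    (hC : IsRDSS (⊤ : SimpleGraph (Fin (m + 1))).Adj C) :
    Set.InjOn (fun x : Fin (m + 1) → A => fun i : Fin m => x i.succ) C := by
  intro x hx y hy h
  have hsucc : ∀ i : Fin m, x i.succ = y i.succ := congrFun h
  refine funext (Fin.cases (hC 0 x hx y hy fun j hj => ?_) hsucc)
  obtain ⟨k, rfl⟩ := Fin.exists_succ_eq.mpr (Ne.symm hj)
  exact hsucc k

theorem IsRDSS.ncard_le {m : ℕ} {A : Type*} [Finite A] {C : Set (Fin (m + 1) → A)}
    (hC : IsRDSS (⊤ : SimpleGraph (Fin (m + 1))).Adj C) : C.ncard ≤ Nat.card A ^ m := by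
  rw [← hC.injOn_tail.ncard_image]
  refine (Set.ncard_le_card _).trans_eq ?_
  rw [Nat.card_fun, Nat.card_fin]

/-- the maximum size of an RDSS code for the complete graph `K_n`
over an alphabet of size `q` equals `q^{n−1}`: the zero-sum code over `ZMod q`
achieves it, and no RDSS code over any alphabet of size `q` can be larger. -/
theorem stmt19 {n q : ℕ} (hn : 1 ≤ n) (hq : 2 ≤ q) :
    (IsRDSS (⊤ : SimpleGraph (Fin n)).Adj {x : Fin n → ZMod q | ∑ i, x i = 0} ∧
      ({x : Fin n → ZMod q | ∑ i, x i = 0}).ncard = q ^ (n - 1)) ∧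
    ∀ (A : Type) (instA : Fintype A), @Fintype.card A instA = q →
      ∀ C : Set (Fin n → A), IsRDSS (⊤ : SimpleGraph (Fin n)).Adj C →
        C.ncard ≤ q ^ (n - 1) := by
  obtain ⟨m, rfl⟩ := Nat.exists_eq_add_of_le' hn
  refine ⟨⟨isRDSS_top_zero_sum, ?_⟩, fun A _ hA C hC => ?_⟩
  · simpa using ncard_zero_sum (m := m) (A := ZMod q)
  · simpa [hA] using hC.ncard_le
end
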